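/- arXiv:2510.15169 — 2 statements merged into one kernel-verified Lean document; each statement's English description precedes it below -/
import Mathlib

section
/- Let n ≥ 2 and 1 ≤ m ≤ n−1, and let a_1,…,a_{n−1} be positive integers satisfying a_1 > a_2 > ⋯ > a_{n−m} and a_{n−m} < a_{n−m+1} < ⋯ < a_{n−1}. Set λ := Σ_{i=1}^{n−1} a_i α_i. Then the weighted Kostant sum satisfies S(λ) = q^{−Σ_{i=1}^{n−1} a_i} · (q−1)^{2(n−1)} · [a_{n−m}]_{q^n} · ∏_{i=1}^{n−m−1} [(i+1)a_i − i·a_{i+1}]_q · ∏_{j=1}^{m−1} [(j+1)a_{n−j} − j·a_{n−j−1}]_q. (Equivalently, by Opdam's formula this is the value of the standard trace τ(θ_{−λ}) in the extended affine Hecke algebra of type A_{n−1}.) -/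
noncomputable def q : RatFunc ℚ := RatFunc.X

noncomputable def qint (b : RatFunc ℚ) (k : ℤ) : RatFunc ℚ := (b ^ k - 1) / (b - 1)

noncomputable def wt (r : ℕ) : RatFunc ℚ :=
  if r = 0 then 1
  else q ^ (-(r : ℤ)) * (q - 1) ^ 2 * (q ^ (2 * r) - 1) / (q ^ 2 - 1)

def rootZ (i j : ℕ) : ℕ → ℤ := fun k => (if k = i then 1 else 0) - (if k = j then 1 else 0)

def pairs (n : ℕ) : Finset (ℕ × ℕ) :=
  (Finset.Icc 1 n ×ˢ Finset.Icc 1 n).filter fun p => p.1 < p.2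

def IsKostant (n : ℕ) (lam : ℕ → ℤ) (r : ℕ × ℕ → ℕ) : Prop :=
  (∀ p ∉ pairs n, r p = 0) ∧
    (∑ p ∈ pairs n, (r p : ℤ) • rootZ p.1 p.2) = lam

noncomputable def S (n : ℕ) (lam : ℕ → ℤ) : RatFunc ℚ :=
  ∑ᶠ r ∈ {r : ℕ × ℕ → ℕ | IsKostant n lam r}, ∏ p ∈ pairs n, wt (r p)

section KostantAux
open Finset
variable {F : Type*} [Field F]

def DD (α β : F) (r : ℕ) : F :=
  if r = 0 then 1 else (α - 1) * (1 - β) / (α - β) * (α ^ r - β ^ r)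

lemma geo_ser (α : F) : (PowerSeries.mk fun r => α ^ r) * (1 - PowerSeries.C α * PowerSeries.X) = 1 := by
  ext n
  cases n with
  | zero => simp
  | succ n =>
    rw [mul_sub, mul_one, map_sub, mul_comm (PowerSeries.C α), ← mul_assoc,
      PowerSeries.coeff_mul_C, PowerSeries.coeff_succ_mul_X]
    simp [PowerSeries.coeff_one, pow_succ]

lemma DD_ser (α β : F) (h : α ≠ β) :
    PowerSeries.mk (DD α β) * ((1 - PowerSeries.C α * PowerSeries.X) * (1 - PowerSeries.C β * PowerSeries.X))
      = (1 - PowerSeries.X) * (1 - PowerSeries.C (α * β) * PowerSeries.X) := by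
  have hU := geo_ser α
  have hV := geo_ser β
  have h' : α - β ≠ 0 := sub_ne_zero.mpr h
  set c := (α - 1) * (1 - β) / (α - β) with hc
  have h1 : PowerSeries.mk (DD α β) = 1 + PowerSeries.C c *
      ((PowerSeries.mk fun r => α ^ r) - (PowerSeries.mk fun r => β ^ r)) := by
    ext n
    rw [map_add, PowerSeries.coeff_C_mul]
    cases n with
    | zero => simp [DD]
    | succ n => simp [DD, PowerSeries.coeff_one, hc]
  have hcc : PowerSeries.C c * (PowerSeries.C α - PowerSeries.C β)
      = (PowerSeries.C α - 1) * (1 - PowerSeries.C β) := by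
    rw [← map_sub, ← map_mul, hc, div_mul_cancel₀ _ h']
    simp
  rw [h1, map_mul]
  generalize (PowerSeries.mk fun r => α ^ r) = U at *
  generalize (PowerSeries.mk fun r => β ^ r) = V at *
  linear_combination PowerSeries.C c * (1 - PowerSeries.C β * PowerSeries.X) * hU
    - PowerSeries.C c * (1 - PowerSeries.C α * PowerSeries.X) * hV + PowerSeries.X * hcc

lemma DD_ser_scaled (α β P : F) (h : α ≠ β) :
    PowerSeries.mk (fun r => DD α β r * P ^ r) *
      ((1 - PowerSeries.C (α * P) * PowerSeries.X) * (1 - PowerSeries.C (β * P) * PowerSeries.X))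
      = (1 - PowerSeries.C P * PowerSeries.X) * (1 - PowerSeries.C (α * β * P) * PowerSeries.X) := by
  have hC : ∀ c : F, PowerSeries.rescale P (PowerSeries.C c) = PowerSeries.C c := by
    intro c; ext n
    rw [PowerSeries.coeff_rescale, PowerSeries.coeff_C]
    split_ifs with h <;> simp [h]
  have := congrArg (PowerSeries.rescale P) (DD_ser α β h)
  simp only [map_mul, map_sub, map_one, PowerSeries.rescale_X, hC] at this
  have e : PowerSeries.rescale P (PowerSeries.mk (DD α β)) = PowerSeries.mk (fun r => DD α β r * P ^ r) := by
    ext n; simp [PowerSeries.coeff_rescale, mul_comm]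
  rw [e] at this
  simp only [map_mul]
  linear_combination this

lemma one_sub_ne (a : F) : (1 - PowerSeries.C a * PowerSeries.X : PowerSeries F) ≠ 0 := by
  intro h
  have := congrArg PowerSeries.constantCoeff h
  simp at this

lemma conv_of_ser (f g h : ℕ → F) (H : PowerSeries.mk f * PowerSeries.mk g = PowerSeries.mk h) (u : ℕ) :
    ∑ s ∈ range (u + 1), f (u - s) * g s = h u := by
  have := congrArg (PowerSeries.coeff u) H
  rw [mul_comm, PowerSeries.coeff_mul, PowerSeries.coeff_mk] at this
  rw [← this, Finset.Nat.sum_antidiagonal_eq_sum_range_succ_mk]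
  simp [mul_comm]

lemma conv1 (α β x : F) (hx : x ≠ 0) (h1 : α ≠ β) (h2 : α ≠ x⁻¹) (h3 : α ≠ β * x⁻¹) (u : ℕ) :
    ∑ s ∈ range (u + 1), DD α β (u - s) * (DD α x⁻¹ s * x ^ s) = x ^ u * DD α (β * x⁻¹) u := by
  rw [mul_comm]
  refine conv_of_ser (DD α β) (fun s => DD α x⁻¹ s * x ^ s) (fun u => DD α (β * x⁻¹) u * x ^ u) ?_ u
  have e1 := DD_ser α β h1
  have e2 := DD_ser_scaled α x⁻¹ x h2
  have e3 := DD_ser_scaled α (β * x⁻¹) x h3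
  rw [inv_mul_cancel₀ hx, mul_assoc α, inv_mul_cancel₀ hx, mul_one, map_one, one_mul] at e2
  rw [mul_assoc α, mul_assoc β, inv_mul_cancel₀ hx, mul_one] at e3
  have n1 := one_sub_ne α
  have n2 := one_sub_ne β
  have n3 := one_sub_ne (α * x)
  have n4 : (1 - PowerSeries.X : PowerSeries F) ≠ 0 := by simpa using one_sub_ne (1 : F)
  generalize PowerSeries.mk (DD α β) = A at *
  generalize PowerSeries.mk (fun s => DD α x⁻¹ s * x ^ s) = B at *
  generalize PowerSeries.mk (fun u => DD α (β * x⁻¹) u * x ^ u) = H at *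
  generalize (1 - PowerSeries.C α * PowerSeries.X : PowerSeries F) = a1 at *
  generalize (1 - PowerSeries.C β * PowerSeries.X : PowerSeries F) = a2 at *
  generalize (1 - PowerSeries.C (α * x) * PowerSeries.X : PowerSeries F) = a3 at *
  generalize (1 - PowerSeries.C (α * β) * PowerSeries.X : PowerSeries F) = a5 at *
  generalize (1 - PowerSeries.C x * PowerSeries.X : PowerSeries F) = a6 at *
  generalize (1 - PowerSeries.X : PowerSeries F) = a4 at *
  apply mul_right_cancel₀ (mul_ne_zero (mul_ne_zero n1 n2) (mul_ne_zero n3 n4))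
  linear_combination B * (a3 * a4) * e1 + a4 * a5 * e2 - a1 * a4 * e3

lemma conv2 (α β x : F) (h1 : α ≠ β) (h2 : α ≠ x⁻¹) (h3 : α ≠ β * x⁻¹) (u : ℕ) :
    ∑ s ∈ range (u + 1), DD α β (u - s) * (DD α x⁻¹ s * β ^ s) = DD α (β * x⁻¹) u := by
  refine conv_of_ser (DD α β) (fun s => DD α x⁻¹ s * β ^ s) (fun u => DD α (β * x⁻¹) u) ?_ u
  have e1 := DD_ser α β h1
  have e2 := DD_ser_scaled α x⁻¹ β h2
  have e3 := DD_ser α (β * x⁻¹) h3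
  rw [show α * x⁻¹ * β = α * (β * x⁻¹) by ring, mul_comm x⁻¹ β] at e2
  have n1 := one_sub_ne α
  have n2 := one_sub_ne β
  have n3 := one_sub_ne (α * β)
  have n4 := one_sub_ne (β * x⁻¹)
  change _ = PowerSeries.mk (DD α (β * x⁻¹))
  generalize PowerSeries.mk (DD α β) = A at *
  generalize PowerSeries.mk (fun s => DD α x⁻¹ s * β ^ s) = B at *
  generalize PowerSeries.mk (DD α (β * x⁻¹)) = H at *
  generalize (1 - PowerSeries.C α * PowerSeries.X : PowerSeries F) = a1 at *
  generalize (1 - PowerSeries.C β * PowerSeries.X : PowerSeries F) = a2 at *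
  generalize (1 - PowerSeries.C (α * β) * PowerSeries.X : PowerSeries F) = a5 at *
  generalize (1 - PowerSeries.C (β * x⁻¹) * PowerSeries.X : PowerSeries F) = a6 at *
  generalize (1 - PowerSeries.C (α * (β * x⁻¹)) * PowerSeries.X : PowerSeries F) = a7 at *
  generalize (1 - PowerSeries.X : PowerSeries F) = a4 at *
  apply mul_right_cancel₀ (mul_ne_zero (mul_ne_zero n1 n2) (mul_ne_zero n3 n4))
  linear_combination B * (a5 * a6) * e1 + a4 * a5 * e2 - a2 * a5 * e3

def Zr (w : ℕ × ℕ → ℕ → F) : List ℕ → (ℕ → ℤ) → F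
  | [], _ => 1
  | v :: L, lam => if 0 ≤ lam v then
      ∑ t ∈ piAntidiag L.toFinset (lam v).toNat,
        (∏ j ∈ L.toFinset, w (v, j) (t j)) * Zr w L (fun k => lam k + t k) else 0

lemma Zr_congr (w w' : ℕ × ℕ → ℕ → F) (L : List ℕ) : ∀ (lam lam' : ℕ → ℤ),
    (∀ i ∈ L, ∀ j, w (i, j) = w' (i, j)) →
    (∀ k ∈ L, lam k = lam' k) → Zr w L lam = Zr w' L lam' := by
  induction L with
  | nil => intros; rfl
  | cons v L ih =>
    intro lam lam' hw h
    simp only [Zr]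
    rw [h v (by simp)]
    congr 1
    refine sum_congr rfl fun t _ => ?_
    rw [ih _ (fun k => lam' k + t k) (fun i hi => hw i (by simp [hi]))
      (fun k hk => by rw [h k (by simp [hk])])]
    simp only [hw v (by simp)]

def EE : List ℕ → Finset (ℕ × ℕ)
  | [] => ∅
  | v :: L => L.toFinset.image (Prod.mk v) ∪ EE L

lemma mem_EE (L : List ℕ) (i j : ℕ) : (i, j) ∈ EE L ↔ [i, j].Sublist L := by
  induction L with
  | nil => simp [EE]
  | cons v L ih =>
    simp only [EE, mem_union, mem_image, List.mem_toFinset, ih, List.sublist_cons_iff,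
      List.cons.injEq, Prod.mk.injEq]
    constructor
    · rintro (⟨a, ha, rfl, rfl⟩ | h)
      · right; exact ⟨[a], ⟨rfl, rfl⟩, by simpa using ha⟩
      · left; exact h
    · rintro (h | ⟨r, ⟨rfl, rfl⟩, h⟩)
      · right; exact h
      · left; exact ⟨j, by simpa using h, rfl, rfl⟩

lemma EE_mem_left {L : List ℕ} {i j : ℕ} (h : (i, j) ∈ EE L) : i ∈ L :=
  ((mem_EE L i j).1 h).subset (by simp)

lemma EE_mem_right {L : List ℕ} {i j : ℕ} (h : (i, j) ∈ EE L) : j ∈ L :=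
  ((mem_EE L i j).1 h).subset (by simp)

def comb (v : ℕ) (t : ℕ → ℕ) (r : ℕ × ℕ → ℕ) : ℕ × ℕ → ℕ :=
  fun p => if p.1 = v then t p.2 else r p

open Classical in
noncomputable def Flows : List ℕ → (ℕ → ℤ) → Finset (ℕ × ℕ → ℕ)
  | [], _ => {0}
  | v :: L, lam => if 0 ≤ lam v then
      ((piAntidiag L.toFinset (lam v).toNat).sigma
        (fun t => Flows L (fun k => lam k + t k))).image (fun x => comb v x.1 x.2) else ∅

lemma mem_Flows (L : List ℕ) (hL : L.Nodup) : ∀ (lam : ℕ → ℤ) (r : ℕ × ℕ → ℕ),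
    r ∈ Flows L lam ↔ (∀ p, p ∉ EE L → r p = 0) ∧
      ∀ k ∈ L, (∑ j ∈ L.toFinset, (r (k, j) : ℤ)) - ∑ i ∈ L.toFinset, (r (i, k) : ℤ) = lam k := by
  induction L with
  | nil =>
    intro lam r
    simp only [Flows, mem_singleton, EE, notMem_empty, not_false_eq_true, forall_const,
      List.not_mem_nil, false_imp_iff, implies_true, and_true]
    exact ⟨fun h p => by simp [h], fun h => funext h⟩
  | cons v L ih =>
    intro lam r
    obtain ⟨hv, hL'⟩ := List.nodup_cons.1 hL
    have hv' : v ∉ L.toFinset := by simpa using hv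
    have ih := ih hL'
    simp only [Flows]
    constructor
    · intro h
      split_ifs at h with h0
      swap
      · simp at h
      simp only [mem_image, mem_sigma, Sigma.exists] at h
      obtain ⟨t, r', ⟨ht, hr'⟩, rfl⟩ := h
      rw [mem_piAntidiag] at ht
      obtain ⟨hts, htz⟩ := ht
      rw [ih] at hr'
      obtain ⟨hz, hc⟩ := hr'
      have hr'v : ∀ i, r' (i, v) = 0 := fun i => hz _ fun h => hv (EE_mem_right h)
      have htv : t v = 0 := by
        by_contra h; exact hv' (htz v h)
      refine ⟨?_, ?_⟩
      · rintro ⟨i, j⟩ hp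
        simp only [EE, mem_union, mem_image, not_or, not_exists, not_and] at hp
        unfold comb
        split_ifs with hi
        · simp only at hi
          subst hi
          by_contra h
          exact hp.1 j (htz j h) rfl
        · exact hz _ hp.2
      · intro k hk
        rw [List.toFinset_cons, sum_insert hv', sum_insert hv']
        have e1 : ∑ i ∈ L.toFinset, (comb v t r' (i, k) : ℤ) = ∑ i ∈ L.toFinset, (r' (i, k) : ℤ) := by
          refine sum_congr rfl fun i hi => ?_
          have : i ≠ v := by rintro rfl; exact hv' hi
          simp [comb, this]
        rw [e1]
        rcases List.mem_cons.1 hk with hk | hk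
        · subst hk
          simp only [comb, if_true, hr'v, htv]
          have : (∑ j ∈ L.toFinset, (t j : ℤ)) = lam k := by
            rw [← Nat.cast_sum, hts]; omega
          simp [this]
        · have hkv : k ≠ v := fun e => hv (e ▸ hk)
          have := hc k hk
          simp only [comb, hkv, if_true, if_false, hr'v]
          push_cast
          linarith
    · rintro ⟨hz, hc⟩
      have hrv : ∀ i, r (i, v) = 0 := by
        intro i
        apply hz
        simp only [EE, mem_union, mem_image, not_or, not_exists, not_and]
        refine ⟨fun x hx h => ?_, fun h => hv (EE_mem_right h)⟩
        simp only [Prod.mk.injEq] at h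
        exact hv' (h.2 ▸ hx)
      have h1 := hc v (by simp)
      simp only [List.toFinset_cons, sum_insert hv', hrv, Nat.cast_zero, sum_const_zero, add_zero,
        sub_zero, zero_add] at h1
      have h0 : 0 ≤ lam v := by rw [← h1]; positivity
      rw [if_pos h0]
      simp only [mem_image, mem_sigma, Sigma.exists]
      refine ⟨fun j => r (v, j), fun p => if p.1 = v then 0 else r p, ⟨?_, ?_⟩, ?_⟩
      · rw [mem_piAntidiag]
        refine ⟨?_, ?_⟩
        · zify; rw [h1]; omega
        · intro j hj
          by_contra hjL
          apply hj
          apply hz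
          simp only [EE, mem_union, mem_image, not_or, not_exists, not_and]
          refine ⟨fun x hx h => ?_, fun h => hv (EE_mem_left h)⟩
          simp only [Prod.mk.injEq] at h
          exact hjL (h.2 ▸ hx)
      · rw [ih]
        refine ⟨?_, ?_⟩
        · rintro ⟨i, j⟩ hp
          simp only
          split_ifs with hi
          · rfl
          · apply hz
            simp only [EE, mem_union, mem_image, not_or, not_exists, not_and]
            refine ⟨fun x hx h => ?_, hp⟩
            simp only [Prod.mk.injEq] at h
            exact hi h.1.symm
        · intro k hk
          have hkv : k ≠ v := by rintro rfl; exact hv hk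
          have := hc k (by simp [hk])
          rw [List.toFinset_cons, sum_insert hv', sum_insert hv', hrv] at this
          have e1 : ∑ i ∈ L.toFinset, (((if i = v then 0 else r (i, k) : ℕ)) : ℤ) = ∑ i ∈ L.toFinset, (r (i, k) : ℤ) := by
            refine sum_congr rfl fun i hi => ?_
            have : i ≠ v := by rintro rfl; exact hv' hi
            simp [this]
          simp only [hkv, if_false]
          rw [e1]
          push_cast at this
          linarith
      · funext p
        rcases p with ⟨i, j⟩
        simp only [comb]
        split_ifs with h
        · rw [h]
        · rfl

lemma Zr_eq (w : ℕ × ℕ → ℕ → F) (L : List ℕ) (hL : L.Nodup) : ∀ (lam : ℕ → ℤ),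
    Zr w L lam = ∑ r ∈ Flows L lam, ∏ p ∈ EE L, w p (r p) := by
  induction L with
  | nil => intro lam; simp [Zr, Flows, EE]
  | cons v L ih =>
    intro lam
    obtain ⟨hv, hL'⟩ := List.nodup_cons.1 hL
    have hv' : v ∉ L.toFinset := by simpa using hv
    simp only [Zr, Flows]
    split_ifs with h0
    swap
    · simp
    classical
    rw [sum_image, sum_sigma]
    · refine sum_congr rfl fun t ht => ?_
      rw [ih hL', mul_sum]
      refine sum_congr rfl fun r hr => ?_
      simp only [EE]
      rw [prod_union]
      · rw [prod_image (by intro a _ b _ h; simpa using h)]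
        congr 1
        · simp [comb]
        · refine prod_congr rfl ?_
          rintro ⟨i, j⟩ hp
          have : i ≠ v := by rintro rfl; exact hv (EE_mem_left hp)
          simp [comb, this]
      · rw [disjoint_left]
        rintro ⟨i, j⟩ h1 h2
        simp only [mem_image, Prod.mk.injEq] at h1
        obtain ⟨a, _, rfl, _⟩ := h1
        exact hv (EE_mem_left h2)
    · rintro ⟨t, r⟩ h1 ⟨t', r'⟩ h2 h
      simp only [coe_sigma, Set.mem_sigma_iff, mem_coe, mem_Flows L hL'] at h1 h2
      simp only at h
      have e1 : t = t' := by
        funext j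
        have := congrFun h (v, j)
        simpa [comb] using this
      subst e1
      have e2 : r = r' := by
        funext p
        rcases p with ⟨i, j⟩
        by_cases hi : i = v
        · subst hi
          rw [h1.2.1 _ fun h => hv (EE_mem_left h), h2.2.1 _ fun h => hv (EE_mem_left h)]
        · have := congrFun h (i, j)
          simpa [comb, hi] using this
      subst e2
      rfl

lemma mem_EE_reverse (L : List ℕ) (i j : ℕ) : (i, j) ∈ EE L.reverse ↔ (j, i) ∈ EE L := by
  rw [mem_EE, mem_EE, ← List.reverse_sublist]
  simp

lemma Zr_reverse (w : ℕ × ℕ → ℕ → F) (L : List ℕ) (hL : L.Nodup) (lam : ℕ → ℤ) :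
    Zr w L lam = Zr (fun p => w p.swap) L.reverse (fun k => - lam k) := by
  rw [Zr_eq w L hL, Zr_eq _ L.reverse (List.nodup_reverse.2 hL)]
  have hm : ∀ r, r ∈ Flows L.reverse (fun k => - lam k) ↔ r ∘ Prod.swap ∈ Flows L lam := by
    intro r
    rw [mem_Flows _ hL, mem_Flows _ (List.nodup_reverse.2 hL)]
    simp only [List.mem_reverse, List.toFinset_reverse, Function.comp, Prod.swap_prod_mk, Prod.forall,
      mem_EE_reverse, Prod.swap]
    constructor
    · rintro ⟨h1, h2⟩
      exact ⟨fun a b h => h1 b a h, fun k hk => by linarith [h2 k hk]⟩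
    · rintro ⟨h1, h2⟩
      exact ⟨fun a b h => h1 b a h, fun k hk => by linarith [h2 k hk]⟩
  refine sum_nbij' (fun r => r ∘ Prod.swap) (fun r => r ∘ Prod.swap) ?_ ?_ ?_ ?_ ?_
  · intro r hr
    rw [hm]
    simpa [Function.comp_assoc] using hr
  · intro r hr
    exact (hm r).1 hr
  · intro r _
    funext p; simp
  · intro r _
    funext p; simp
  · intro r _
    refine prod_nbij' Prod.swap Prod.swap ?_ ?_ ?_ ?_ ?_
    · rintro ⟨i, j⟩ h
      simpa [mem_EE_reverse] using h
    · rintro ⟨i, j⟩ h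
      simpa [mem_EE_reverse] using h
    · simp
    · simp
    · simp

def ext0 (s : Finset ℕ) (f : ∀ a ∈ s, ℕ) : ℕ → ℕ := fun j => if h : j ∈ s then f j h else 0

open Classical in
noncomputable def kbox (s : Finset ℕ) (u : ℕ → ℕ) : Finset (ℕ → ℕ) :=
  (s.pi fun j => range (u j + 1)).image (ext0 s)

lemma mem_box (s : Finset ℕ) (u σ : ℕ → ℕ) :
    σ ∈ kbox s u ↔ (∀ j ∉ s, σ j = 0) ∧ ∀ j ∈ s, σ j ≤ u j := by
  simp only [kbox, mem_image, mem_pi, mem_range]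
  constructor
  · rintro ⟨f, hf, rfl⟩
    refine ⟨fun j hj => by simp [ext0, hj], fun j hj => ?_⟩
    simp only [ext0, hj, dif_pos]
    have := hf j hj
    omega
  · rintro ⟨h1, h2⟩
    refine ⟨fun j _ => σ j, fun j hj => Nat.lt_succ_of_le (h2 j hj), ?_⟩
    funext j
    by_cases hj : j ∈ s
    · simp [ext0, hj]
    · simp [ext0, hj, h1 j hj]

lemma prod_sum_box (s : Finset ℕ) (u : ℕ → ℕ) (f : ℕ → ℕ → F) :
    ∏ j ∈ s, ∑ x ∈ range (u j + 1), f j x = ∑ σ ∈ kbox s u, ∏ j ∈ s, f j (σ j) := by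
  classical
  rw [prod_sum, kbox, sum_image]
  · refine sum_congr rfl fun p hp => ?_
    rw [← prod_attach s]
    refine prod_congr rfl fun x _ => ?_
    simp [ext0]
  · intro p _ p' _ h
    funext j hj
    have := congrFun h j
    simpa [ext0, hj] using this

def YY (w : ℕ × ℕ → ℕ → F) (wb : ℕ → ℕ → F) (A : ℕ) (L : List ℕ) (lam : ℕ → ℤ) : F :=
  ∑ t ∈ piAntidiag L.toFinset A, (∏ j ∈ L.toFinset, wb j (t j)) * Zr w L (fun k => lam k + t k)

lemma YY_eq_Zr (w : ℕ × ℕ → ℕ → F) (v : ℕ) (L : List ℕ) (lam : ℕ → ℤ) (A : ℕ) (h : lam v = A) :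
    Zr w (v :: L) lam = YY w (fun j => w (v, j)) A L lam := by
  simp only [Zr, YY]
  rw [if_pos (by omega)]
  simp [h]

lemma merge (w : ℕ × ℕ → ℕ → F) (wb wb' : ℕ → ℕ → F) (c : ℕ) (L : List ℕ) (hc : c ∉ L)
    (lam : ℕ → ℤ) (A d : ℕ) (hd : 0 < d) (hdA : d ≤ A) (hlam : lam c = -(d : ℤ)) (cc P Q : F)
    (h0 : ∀ r, 0 < r → wb c r = cc * (P ^ r - Q ^ r))
    (h1 : ∀ j ∈ L, ∀ u, ∑ s ∈ range (u + 1), wb j (u - s) * (w (c, j) s * P ^ s) = P ^ u * wb' j u)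
    (h2 : ∀ j ∈ L, ∀ u, ∑ s ∈ range (u + 1), wb j (u - s) * (w (c, j) s * Q ^ s) = wb' j u) :
    YY w wb A (c :: L) lam = cc * (P ^ A - Q ^ d) * YY w wb' (A - d) L lam := by
  have hc' : c ∉ L.toFinset := by simpa using hc
  set s := L.toFinset with hs
  -- right-hand side
  have key : ∀ u ∈ piAntidiag s (A - d),
      cc * (P ^ A - Q ^ d) * ∏ j ∈ s, wb' j (u j) =
      ∑ σ ∈ kbox s u, wb c (d + ∑ j ∈ s, σ j) *
        ((∏ j ∈ s, wb j (u j - σ j)) * ∏ j ∈ s, w (c, j) (σ j)) := by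
    intro u hu
    have hus : ∑ j ∈ s, u j = A - d := (mem_piAntidiag.1 hu).1
    have k1 : P ^ (A - d) * ∏ j ∈ s, wb' j (u j) =
        ∑ σ ∈ kbox s u, ∏ j ∈ s, (wb j (u j - σ j) * (w (c, j) (σ j) * P ^ (σ j))) := by
      rw [← prod_sum_box s u (fun j x => wb j (u j - x) * (w (c, j) x * P ^ x)), ← hus,
        ← prod_pow_eq_pow_sum, ← prod_mul_distrib]
      refine prod_congr rfl fun j hj => ?_
      rw [h1 j (by simpa [hs] using hj)]
    have k2 : ∏ j ∈ s, wb' j (u j) =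
        ∑ σ ∈ kbox s u, ∏ j ∈ s, (wb j (u j - σ j) * (w (c, j) (σ j) * Q ^ (σ j))) := by
      rw [← prod_sum_box s u (fun j x => wb j (u j - x) * (w (c, j) x * Q ^ x))]
      refine prod_congr rfl fun j hj => ?_
      rw [h2 j (by simpa [hs] using hj)]
    have : cc * (P ^ A - Q ^ d) * ∏ j ∈ s, wb' j (u j) =
        cc * (P ^ d * (P ^ (A - d) * ∏ j ∈ s, wb' j (u j)) - Q ^ d * ∏ j ∈ s, wb' j (u j)) := by
      have : P ^ A = P ^ d * P ^ (A - d) := by rw [← pow_add]; congr 1; omega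
      rw [this]; ring
    rw [this, k1, k2, mul_sum, mul_sum, ← sum_sub_distrib, mul_sum]
    refine sum_congr rfl fun σ _ => ?_
    rw [h0 _ (by omega)]
    simp only [prod_mul_distrib, prod_pow_eq_pow_sum, pow_add]
    ring
  have hR : cc * (P ^ A - Q ^ d) * YY w wb' (A - d) L lam =
      ∑ x ∈ (piAntidiag s (A - d)).sigma (fun u => kbox s u),
        wb c (d + ∑ j ∈ s, x.2 j) *
        ((∏ j ∈ s, wb j (x.1 j - x.2 j)) * ∏ j ∈ s, w (c, j) (x.2 j)) *
          Zr w L (fun k => lam k + x.1 k) := by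
    rw [sum_sigma, YY, mul_sum]
    refine sum_congr rfl fun u hu => ?_
    rw [← mul_assoc, key u hu, sum_mul]
  rw [hR]
  have hL : YY w wb A (c :: L) lam =
      ∑ x ∈ ((piAntidiag (insert c s) A).filter (fun T => d ≤ T c)).sigma
        (fun T => piAntidiag s (T c - d)),
        (wb c (x.1 c) * ∏ j ∈ s, wb j (x.1 j)) * ((∏ j ∈ s, w (c, j) (x.2 j)) *
          Zr w L (fun k => lam k + x.1 k + x.2 k)) := by
    rw [sum_sigma, YY, sum_filter, List.toFinset_cons]
    refine sum_congr rfl fun T hT => ?_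
    rw [prod_insert hc']
    simp only [Zr]
    have e : (0 ≤ lam c + (T c : ℤ)) ↔ d ≤ T c := by rw [hlam]; omega
    have e2 : (lam c + (T c : ℤ)).toNat = T c - d := by rw [hlam]; omega
    simp only [e, e2]
    split_ifs with h
    · rw [mul_sum]
    · simp
  rw [hL]
  refine sum_bij' (fun x _ => ⟨fun j => if j ∈ s then x.1 j + x.2 j else 0, x.2⟩)
    (fun x _ => ⟨fun j => if j ∈ s then x.1 j - x.2 j else if j = c then d + ∑ j ∈ s, x.2 j else 0, x.2⟩)
    ?_ ?_ ?_ ?_ ?_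
  · rintro ⟨T, σ⟩ hx
    simp only [mem_sigma, mem_filter, mem_piAntidiag, sum_insert hc'] at hx
    obtain ⟨⟨⟨hT1, hT2⟩, hT3⟩, hσ1, hσ2⟩ := hx
    change ∑ j ∈ s, σ j = _ at hσ1
    simp only [mem_sigma, mem_piAntidiag, mem_box]
    refine ⟨⟨?_, ?_⟩, ?_, ?_⟩
    · rw [sum_congr rfl (fun j hj => if_pos hj), sum_add_distrib, hσ1]; omega
    · intro j hj; by_contra h; simp [h] at hj
    · intro j hj; by_contra h; exact hj (hσ2 j h)
    · intro j hj; simp [hj]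
  · rintro ⟨u, σ⟩ hx
    simp only [mem_sigma, mem_piAntidiag, mem_box] at hx
    obtain ⟨⟨hu1, hu2⟩, hσ1, hσ2⟩ := hx
    change ∑ j ∈ s, u j = _ at hu1
    simp only [mem_sigma, mem_filter, mem_piAntidiag, sum_insert hc', hc', if_false, if_true]
    have e : ∑ j ∈ s, (u j - σ j) + ∑ j ∈ s, σ j = ∑ j ∈ s, u j := by
      rw [← sum_add_distrib]
      exact sum_congr rfl fun j hj => by have := hσ2 j hj; omega
    refine ⟨⟨⟨?_, ?_⟩, ?_⟩, ?_, ?_⟩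
    · rw [sum_congr rfl (fun j hj => if_pos hj)]; omega
    · intro j hj
      by_cases h : j ∈ s
      · simp [h]
      · by_cases h' : j = c
        · simp [h']
        · simp [h, h'] at hj
    · omega
    · change ∑ j ∈ s, σ j = _
      omega
    · intro j hj; by_contra h; exact hj (hσ1 j h)
  · rintro ⟨T, σ⟩ hx
    simp only [mem_sigma, mem_filter, mem_piAntidiag, sum_insert hc'] at hx
    obtain ⟨⟨⟨hT1, hT2⟩, hT3⟩, hσ1, hσ2⟩ := hx
    change ∑ j ∈ s, σ j = _ at hσ1
    simp only [Sigma.mk.injEq, heq_eq_eq, and_true]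
    funext j
    by_cases h : j ∈ s
    · simp [h]
    · by_cases h' : j = c
      · subst h'; simp [h]; omega
      · simp only [h, h', if_false]
        by_contra h3
        have := hT2 j (fun h => h3 h.symm)
        simp [h, h'] at this
  · rintro ⟨u, σ⟩ hx
    simp only [mem_sigma, mem_piAntidiag, mem_box] at hx
    obtain ⟨⟨hu1, hu2⟩, hσ1, hσ2⟩ := hx
    change ∑ j ∈ s, u j = _ at hu1
    simp only [Sigma.mk.injEq, heq_eq_eq, and_true]
    funext j
    by_cases h : j ∈ s
    · have := hσ2 j h
      simp only [h, if_true]; omega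
    · simp only [h, if_false]
      by_contra h3
      exact h (hu2 j (fun h => h3 h.symm))
  · rintro ⟨T, σ⟩ hx
    simp only [mem_sigma, mem_filter, mem_piAntidiag, sum_insert hc'] at hx
    obtain ⟨⟨⟨hT1, hT2⟩, hT3⟩, hσ1, hσ2⟩ := hx
    change ∑ j ∈ s, σ j = _ at hσ1
    simp only
    have e1 : d + ∑ j ∈ s, σ j = T c := by omega
    rw [e1]
    have e2 : ∏ j ∈ s, wb j ((if j ∈ s then T j + σ j else 0) - σ j) = ∏ j ∈ s, wb j (T j) := by
      refine prod_congr rfl fun j hj => ?_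
      simp [hj]
    rw [e2]
    have e3 : Zr w L (fun k => lam k + ((if k ∈ s then T k + σ k else 0 : ℕ) : ℤ)) =
        Zr w L (fun k => lam k + T k + σ k) := by
      apply Zr_congr _ _ _ _ _ (fun _ _ _ => rfl)
      intro k hk
      have : k ∈ s := by simpa [hs] using hk
      simp [this]; ring
    rw [e3]
    ring

lemma YY_single (w : ℕ × ℕ → ℕ → F) (wb : ℕ → ℕ → F) (A e : ℕ) (lam : ℕ → ℤ) (h : lam e = -(A : ℤ)) :
    YY w wb A [e] lam = wb e A := by
  have : piAntidiag ([e].toFinset) A = {fun j => if j = e then A else 0} := by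
    ext t
    simp only [mem_piAntidiag, List.toFinset_cons, List.toFinset_nil, insert_empty_eq, sum_singleton,
      mem_singleton]
    constructor
    · rintro ⟨h1, h2⟩
      funext j
      by_cases hj : j = e
      · simp [hj, h1]
      · simp only [hj, if_false]
        by_contra h3; exact hj (h2 j h3)
    · rintro rfl
      simp
  rw [YY, this]
  simp [Zr, h]

def wB (x : F) (κ : ℕ → ℕ) (g : ℕ → F) (k j r : ℕ) : F :=
  g j ^ r * DD (x ^ κ j) (x⁻¹ ^ k) r

def MM (x : F) (k A B : ℕ) : F :=
  (x - 1) * (1 - x⁻¹ ^ k) / (x - x⁻¹ ^ k) * (x ^ A - (x⁻¹ ^ k) ^ (A - B))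

lemma pow_ne_inv_pow (x : F) (hx0 : x ≠ 0) (hx : ∀ k, 1 ≤ k → x ^ k ≠ 1) (a b : ℕ) (ha : 1 ≤ a) :
    x ^ a ≠ x⁻¹ ^ b := by
  intro h
  apply hx (a + b) (by omega)
  rw [pow_add, h, ← mul_pow, inv_mul_cancel₀ hx0, one_pow]

lemma phase (x : F) (hx0 : x ≠ 0) (hx : ∀ k, 1 ≤ k → x ^ k ≠ 1) (κ : ℕ → ℕ) (hκ : ∀ j, 1 ≤ κ j)
    (g : ℕ → F) (w : ℕ × ℕ → ℕ → F) (hw : ∀ i j r, w (i, j) r = wB x κ g 1 j r)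
    (L : ℕ → List ℕ) (v A : ℕ → ℕ) (lam : ℕ → ℤ) (K : ℕ) (hK : 1 ≤ K)
    (hL : ∀ k, 1 ≤ k → k < K → L k = v k :: L (k + 1))
    (hv : ∀ k, 1 ≤ k → k < K → v k ∉ L (k + 1))
    (hA : ∀ k, 1 ≤ k → k < K → A (k + 1) < A k)
    (hlam : ∀ k, 1 ≤ k → k < K → lam (v k) = (A (k + 1) : ℤ) - A k)
    (hκ1 : ∀ k, 1 ≤ k → k < K → κ (v k) = 1)
    (hg1 : ∀ k, 1 ≤ k → k < K → g (v k) = 1) :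
    YY w (wB x κ g 1) (A 1) (L 1) lam =
      (∏ k ∈ Ico 1 K, MM x k (A k) (A (k + 1))) * YY w (wB x κ g K) (A K) (L K) lam := by
  induction K, hK using Nat.le_induction with
  | base => simp
  | succ K hK ih =>
    rw [ih (fun k h1 h2 => hL k h1 (by omega)) (fun k h1 h2 => hv k h1 (by omega))
      (fun k h1 h2 => hA k h1 (by omega)) (fun k h1 h2 => hlam k h1 (by omega))
      (fun k h1 h2 => hκ1 k h1 (by omega)) (fun k h1 h2 => hg1 k h1 (by omega)),
      prod_Ico_succ_top hK, hL K hK (by omega)]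
    have hA' := hA K hK (by omega)
    rw [merge w (wB x κ g K) (wB x κ g (K + 1)) (v K) (L (K + 1)) (hv K hK (by omega)) lam (A K)
      (A K - A (K + 1)) (by omega) (by omega) (by rw [hlam K hK (by omega)]; omega)
      ((x - 1) * (1 - x⁻¹ ^ K) / (x - x⁻¹ ^ K)) x (x⁻¹ ^ K)]
    · rw [show A K - (A K - A (K + 1)) = A (K + 1) by omega, MM]
      ring
    · intro r hr
      simp [wB, hκ1 K hK (by omega), hg1 K hK (by omega), DD, hr.ne']
    · intro j _ u
      have := conv1 (x ^ κ j) (x⁻¹ ^ K) x hx0 (pow_ne_inv_pow x hx0 hx _ _ (hκ j))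
        (by simpa using pow_ne_inv_pow x hx0 hx (κ j) 1 (hκ j))
        (by rw [← pow_succ]; exact pow_ne_inv_pow x hx0 hx (κ j) _ (hκ j)) u
      simp only [wB, hw]
      rw [pow_succ _ K, show x ^ u * (g j ^ u * DD (x ^ κ j) (x⁻¹ ^ K * x⁻¹) u) =
        g j ^ u * (x ^ u * DD (x ^ κ j) (x⁻¹ ^ K * x⁻¹) u) by ring, ← this, mul_sum]
      refine sum_congr rfl fun s hs => ?_
      have : g j ^ u = g j ^ (u - s) * g j ^ s := by
        rw [← pow_add]; congr 1; have := mem_range.1 hs; omega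
      rw [this, pow_one]; ring
    · intro j _ u
      have := conv2 (x ^ κ j) (x⁻¹ ^ K) x (pow_ne_inv_pow x hx0 hx _ _ (hκ j))
        (by simpa using pow_ne_inv_pow x hx0 hx (κ j) 1 (hκ j))
        (by rw [← pow_succ]; exact pow_ne_inv_pow x hx0 hx (κ j) _ (hκ j)) u
      simp only [wB, hw]
      rw [pow_succ _ K, ← this, mul_sum]
      refine sum_congr rfl fun s hs => ?_
      have : g j ^ u = g j ^ (u - s) * g j ^ s := by
        rw [← pow_add]; congr 1; have := mem_range.1 hs; omega
      rw [this, pow_one]; ring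

lemma inv_pow_eq (x : F) (k : ℕ) : x⁻¹ ^ k = x ^ (-(k : ℤ)) := by
  rw [zpow_neg, zpow_natCast, inv_pow]

lemma MM_eq (x : F) (hx0 : x ≠ 0) (hx : ∀ k, 1 ≤ k → x ^ k ≠ 1) (k A B : ℕ) (h : B ≤ A) :
    MM x k A B = (x - 1) ^ 2 * ((x ^ k - 1) / (x ^ (k + 1) - 1)) * x ^ (-(k * A : ℤ) + k * B) *
      ((x ^ (((k : ℤ) + 1) * A - k * B) - 1) / (x - 1)) := by
  have h1 : x - 1 ≠ 0 := by have := hx 1 le_rfl; rw [pow_one] at this; exact sub_ne_zero.2 this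
  have h2 : x ^ (k + 1) - 1 ≠ 0 := sub_ne_zero.2 (hx _ (by omega))
  have hk : x ^ k ≠ 0 := pow_ne_zero _ hx0
  have e1 : (x - 1) * (1 - x⁻¹ ^ k) / (x - x⁻¹ ^ k) = (x - 1) * ((x ^ k - 1) / (x ^ (k + 1) - 1)) := by
    have a1 : 1 - x⁻¹ ^ k = (x ^ k - 1) / x ^ k := by rw [inv_pow]; field_simp
    have a2 : x - x⁻¹ ^ k = (x ^ (k + 1) - 1) / x ^ k := by rw [inv_pow]; field_simp; ring
    rw [a1, a2]
    field_simp
  have e2 : x ^ A - (x⁻¹ ^ k) ^ (A - B) =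
      x ^ (-(k * A : ℤ) + k * B) * (x ^ (((k : ℤ) + 1) * A - k * B) - 1) := by
    rw [mul_sub, mul_one, ← zpow_add₀ hx0, inv_pow_eq, ← zpow_natCast x A, ← zpow_natCast _ (A - B),
      ← zpow_mul]
    push_cast [h]
    ring_nf
  rw [MM, e1, e2]
  field_simp

lemma prod_MM (x : F) (hx0 : x ≠ 0) (hx : ∀ k, 1 ≤ k → x ^ k ≠ 1) (A : ℕ → ℕ) (K : ℕ) (hK : 1 ≤ K)
    (hA : ∀ k, 1 ≤ k → k < K → A (k + 1) < A k) :
    ∏ k ∈ Ico 1 K, MM x k (A k) (A (k + 1)) =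
      (x - 1) ^ (2 * (K - 1)) * ((x - 1) / (x ^ K - 1)) *
        x ^ (-(∑ k ∈ Ico 1 K, (A k : ℤ)) + (K - 1) * A K) *
        ∏ k ∈ Ico 1 K, ((x ^ (((k : ℤ) + 1) * A k - k * A (k + 1)) - 1) / (x - 1)) := by
  have h1 : x - 1 ≠ 0 := by have := hx 1 le_rfl; rw [pow_one] at this; exact sub_ne_zero.2 this
  induction K, hK using Nat.le_induction with
  | base => simp [h1]
  | succ K hK ih =>
    have h2 : x ^ (K + 1) - 1 ≠ 0 := sub_ne_zero.2 (hx _ (by omega))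
    have h3 : x ^ K - 1 ≠ 0 := sub_ne_zero.2 (hx _ (by omega))
    rw [prod_Ico_succ_top hK, prod_Ico_succ_top hK, sum_Ico_succ_top hK,
      ih (fun k h1 h2 => hA k h1 (by omega)), MM_eq x hx0 hx _ _ _ (hA K hK (by omega)).le]
    have e : (-(∑ k ∈ Ico 1 K, (A k : ℤ) + A K) + ((K + 1 : ℕ) - 1) * A (K + 1) : ℤ) =
      (-(∑ k ∈ Ico 1 K, (A k : ℤ)) + (K - 1) * A K) + (-(K * A K : ℤ) + K * A (K + 1)) := by
      push_cast; ring
    rw [e, zpow_add₀ hx0 (-(∑ k ∈ Ico 1 K, (A k : ℤ)) + (K - 1) * A K)]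
    have e2 : (x - 1) ^ (2 * (K + 1 - 1)) = (x - 1) ^ (2 * (K - 1)) * (x - 1) ^ 2 := by
      rw [← pow_add]; congr 1; omega
    rw [e2]
    generalize ∏ k ∈ Ico 1 K, ((x ^ (((k : ℤ) + 1) * A k - k * A (k + 1)) - 1) / (x - 1)) = PP
    generalize (x ^ (((K : ℤ) + 1) * A K - K * A (K + 1)) - 1) / (x - 1) = QQ
    generalize x ^ (-(∑ k ∈ Ico 1 K, (A k : ℤ)) + (K - 1) * A K) = RR
    generalize x ^ (-(K * A K : ℤ) + K * A (K + 1)) = SS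
    generalize (x - 1) ^ (2 * (K - 1)) = TT
    field_simp

lemma mem_EE_range' (n : ℕ) : ∀ a i j, (i, j) ∈ EE (List.range' a n) ↔ a ≤ i ∧ i < j ∧ j < a + n := by
  induction n with
  | zero => intro a i j; simp [EE]; omega
  | succ n ih =>
    intro a i j
    rw [List.range'_succ]
    simp only [EE, mem_union, ih, mem_image, List.mem_toFinset, List.mem_range'_1, Prod.mk.injEq]
    constructor
    · rintro (⟨b, hb, rfl, rfl⟩ | h)
      · omega
      · omega
    · intro h
      by_cases hi : i = a
      · left; exact ⟨j, by omega, hi.symm, rfl⟩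
      · right; omega

lemma pairs_eq (n : ℕ) : pairs n = EE (List.range' 1 n) := by
  ext ⟨i, j⟩
  rw [mem_EE_range', pairs]
  simp only [mem_filter, mem_product, mem_Icc]
  omega

lemma kostant_eval (n : ℕ) (r : ℕ × ℕ → ℕ) (hr : ∀ p ∉ pairs n, r p = 0) (k : ℕ) :
    (∑ p ∈ pairs n, (r p : ℤ) • rootZ p.1 p.2) k =
      if k ∈ Icc 1 n then (∑ j ∈ Icc 1 n, (r (k, j) : ℤ)) - ∑ i ∈ Icc 1 n, (r (i, k) : ℤ) else 0 := by
  have h1 : ∑ p ∈ pairs n, (r p : ℤ) • rootZ p.1 p.2 =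
      ∑ p ∈ Icc 1 n ×ˢ Icc 1 n, (r p : ℤ) • rootZ p.1 p.2 := by
    refine sum_subset (filter_subset _ _) fun p _ hp => ?_
    rw [hr p hp]; simp
  rw [h1, Finset.sum_apply, sum_product]
  simp only [Pi.smul_apply, rootZ, smul_eq_mul, mul_sub, sum_sub_distrib, mul_ite, mul_one, mul_zero]
  rw [sum_comm]
  simp only [sum_ite_eq]
  split_ifs <;> simp

lemma S_eq_Zr (n : ℕ) (lam : ℕ → ℤ) (h : ∀ k ∉ Icc 1 n, lam k = 0) :
    S n lam = Zr (fun _ => wt) (List.range' 1 n) lam := by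
  rw [Zr_eq _ _ List.nodup_range', S, ← pairs_eq]
  have : {r : ℕ × ℕ → ℕ | IsKostant n lam r} = ↑(Flows (List.range' 1 n) lam) := by
    ext r
    rw [mem_coe, mem_Flows _ List.nodup_range', ← pairs_eq]
    have ht : (List.range' 1 n).toFinset = Icc 1 n := by
      ext k; simp; omega
    have hm : ∀ k, k ∈ List.range' 1 n ↔ k ∈ Icc 1 n := by
      intro k; rw [← ht]; simp
    simp only [ht, hm]
    show (_ ∧ _) ↔ _
    refine and_congr_right fun hr => ?_
    constructor
    · intro he k hk
      rw [← he, kostant_eval n r hr, if_pos hk]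
    · intro hc
      funext k
      rw [kostant_eval n r hr]
      split_ifs with hk
      · exact hc k hk
      · exact (h k hk).symm
  rw [this, finsum_mem_coe_finset]

lemma lam_eval (n : ℕ) (a : ℕ → ℤ) (k : ℕ) :
    (∑ i ∈ Icc 1 (n - 1), a i • rootZ i (i + 1)) k =
      (if 1 ≤ k ∧ k ≤ n - 1 then a k else 0) - (if 2 ≤ k ∧ k ≤ n - 1 + 1 then a (k - 1) else 0) := by
  rw [Finset.sum_apply]
  simp only [Pi.smul_apply, rootZ, smul_eq_mul, mul_sub, sum_sub_distrib, mul_ite, mul_one, mul_zero]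
  congr 1
  · simp
  · split_ifs with h
    · rw [sum_eq_single (k - 1)]
      · rw [if_pos (by omega)]
      · intro b _ hb; rw [if_neg (by omega)]
      · intro hb; simp at hb; omega
    · refine sum_eq_zero fun b hb => ?_
      rw [mem_Icc] at hb
      rw [if_neg (by omega)]

lemma Zmain (x : F) (hx0 : x ≠ 0) (hx : ∀ k, 1 ≤ k → x ^ k ≠ 1) (n K m : ℕ) (hn : K + m = n)
    (hK : 1 ≤ K) (hm : 1 ≤ m) (b : ℕ → ℕ) (lam : ℕ → ℤ) (h1 : lam 1 = b 1)
    (h2 : ∀ k, 2 ≤ k → k ≤ n - 1 → lam k = (b k : ℤ) - b (k - 1)) (h3 : lam n = - (b (n - 1) : ℤ))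
    (hdec : ∀ i, 1 ≤ i → i + 1 ≤ K → b (i + 1) < b i)
    (hinc : ∀ i, K ≤ i → i + 1 ≤ n - 1 → b i < b (i + 1)) :
    Zr (fun _ => DD x x⁻¹) (List.range' 1 n) lam =
      (∏ k ∈ Ico 1 K, MM x k (b k) (b (k + 1))) *
      ((∏ k ∈ Ico 1 m, MM x k (b (n - k)) (b (n - (k + 1)))) *
        ((x⁻¹ ^ (K - 1)) ^ b K * DD (x ^ K) (x⁻¹ ^ m) (b K))) := by
  -- phase 1
  have p1 := phase x hx0 hx (fun _ => 1) (fun _ => le_rfl) (fun _ => 1) (fun _ => DD x x⁻¹)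
    (by intro i j r; simp [wB]) (fun k => List.range' (k + 1) (n - k)) (fun k => k + 1) b lam K hK
    (by
      intro k hk1 hk2
      rw [show n - k = (n - (k + 1)) + 1 by omega, List.range'_succ])
    (by intro k hk1 hk2; simp [List.mem_range'_1])
    (fun k hk1 hk2 => hdec k hk1 (by omega))
    (by
      intro k hk1 hk2
      rw [h2 (k + 1) (by omega) (by omega)]; simp)
    (fun _ _ _ => rfl) (fun _ _ _ => rfl)
  have s1 : Zr (fun _ => DD x x⁻¹) (List.range' 1 n) lam =
      YY (fun _ => DD x x⁻¹) (wB x (fun _ => 1) (fun _ => 1) 1) (b 1) (List.range' (1 + 1) (n - 1)) lam := by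
    obtain ⟨N, rfl⟩ : ∃ N, n = N + 1 := ⟨n - 1, by omega⟩
    rw [List.range'_succ, YY_eq_Zr _ _ _ _ _ h1]
    congr 1
    funext j r
    simp [wB]
  rw [s1, p1]
  congr 1
  -- convert back to a flow sum
  set w' : ℕ × ℕ → ℕ → F := fun p => if p.1 = K then DD x (x⁻¹ ^ K) else DD x x⁻¹ with hw'
  set lam' : ℕ → ℤ := fun k => if k = K then (b K : ℤ) else lam k with hlam'
  have s2 : YY (fun _ => DD x x⁻¹) (wB x (fun _ => 1) (fun _ => 1) K) (b K)
      (List.range' (K + 1) (n - K)) lam = Zr w' (List.range' K (n - K + 1)) lam' := by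
    rw [List.range'_succ, YY_eq_Zr w' K _ lam' (b K) (by simp [hlam'])]
    unfold YY
    refine sum_congr rfl fun t _ => ?_
    congr 1
    · refine prod_congr rfl fun j _ => ?_
      simp [wB, hw']
    · apply Zr_congr
      · intro i hi j
        have : i ≠ K := by rintro rfl; simp [List.mem_range'_1] at hi
        simp [hw', this]
      · intro k hk
        have : k ≠ K := by rintro rfl; simp [List.mem_range'_1] at hk
        simp [hlam', this]
  rw [s2, Zr_reverse _ _ List.nodup_range']
  have s3 : (List.range' K (n - K + 1)).reverse = n :: (List.range' K (n - K)).reverse := by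
    rw [List.range'_concat, List.reverse_append]
    simp; omega
  have hl3 : (fun k => -lam' k) n = ((b (n - 1) : ℕ) : ℤ) := by
    have : n ≠ K := by omega
    simp [hlam', this, h3]
  rw [s3, YY_eq_Zr _ _ _ _ _ hl3]
  set κ : ℕ → ℕ := fun j => if j = K then K else 1 with hκ
  set g : ℕ → F := fun j => if j = K then x⁻¹ ^ (K - 1) else 1 with hg
  have hw2 : ∀ i j r, (fun p : ℕ × ℕ => w' p.swap) (i, j) r = wB x κ g 1 j r := by
    intro i j r
    by_cases hj : j = K
    · simp only [hw', Prod.swap, hj, if_true, wB, hκ, hg, pow_one, DD]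
      split_ifs with hr
      · simp [hr]
      · have e1 : (x⁻¹ ^ (K - 1)) ^ r * (x ^ K) ^ r = x ^ r := by
          rw [← mul_pow]
          congr 1
          rw [inv_pow]
          have : x ^ K = x ^ (K - 1) * x := by rw [← pow_succ]; congr 1; omega
          rw [this]
          field_simp
        have e2 : (x⁻¹ ^ (K - 1)) ^ r * x⁻¹ ^ r = (x⁻¹ ^ K) ^ r := by
          rw [← mul_pow, ← pow_succ]
          congr 2; omega
        have n1 : x - x⁻¹ ^ K ≠ 0 := sub_ne_zero.2 (by simpa using pow_ne_inv_pow x hx0 hx 1 K le_rfl)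
        have n2 : x ^ K - x⁻¹ ≠ 0 := sub_ne_zero.2 (by simpa using pow_ne_inv_pow x hx0 hx K 1 hK)
        have e3 : (x - 1) * (1 - x⁻¹ ^ K) / (x - x⁻¹ ^ K) = (x ^ K - 1) * (1 - x⁻¹) / (x ^ K - x⁻¹) := by
          rw [div_eq_div_iff n1 n2, inv_pow]
          have : x ^ K ≠ 0 := pow_ne_zero _ hx0
          field_simp
        rw [e3, ← e1, ← e2]
        ring
    · simp [hw', hj, wB, hκ, hg]
  have p2 := phase x hx0 hx κ (by intro j; simp only [hκ]; split_ifs <;> omega) g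
    (fun p => w' p.swap) hw2 (fun k => (List.range' K (n - k + 1 - K)).reverse) (fun k => n - k)
    (fun k => b (n - k)) (fun k => - lam' k) m hm
    (by
      intro k hk1 hk2
      rw [show n - k + 1 - K = (n - (k + 1) + 1 - K) + 1 by omega, List.range'_concat,
        List.reverse_append]
      simp; omega)
    (by
      intro k hk1 hk2
      simp [List.mem_range'_1]; omega)
    (by
      intro k hk1 hk2
      have := hinc (n - (k + 1)) (by omega) (by omega)
      rwa [show n - (k + 1) + 1 = n - k by omega] at this)
    (by
      intro k hk1 hk2
      have : n - k ≠ K := by omega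
      simp only [hlam', this, if_false]
      rw [h2 (n - k) (by omega) (by omega), show n - k - 1 = n - (k + 1) by omega]
      ring)
    (by
      intro k hk1 hk2
      have : n - k ≠ K := by omega
      simp [hκ, this])
    (by
      intro k hk1 hk2
      have : n - k ≠ K := by omega
      simp [hg, this])
  have e5 : (fun j => (fun p : ℕ × ℕ => w' p.swap) (n, j)) = wB x κ g 1 := by
    funext j r; exact hw2 n j r
  rw [e5]
  rw [show n - 1 + 1 - K = n - K by omega] at p2
  rw [p2]
  congr 1
  rw [show n - m + 1 - K = 1 by omega, show n - m = K by omega]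
  have : (List.range' K 1).reverse = [K] := by simp
  rw [this, YY_single _ _ _ _ _ (by simp [hlam'])]
  simp [wB, hκ, hg]

lemma final_alg (x : F) (hx0 : x ≠ 0) (hx : ∀ k, 1 ≤ k → x ^ k ≠ 1) (n K m : ℕ) (hn : K + m = n)
    (hK : 1 ≤ K) (hm : 1 ≤ m) (B : ℕ) (hB : 0 < B) (s1 s2 : ℤ) (P1 P2 : F) :
    ((x - 1) ^ (2 * (K - 1)) * ((x - 1) / (x ^ K - 1)) * x ^ (-s1 + (K - 1) * B) * P1) *
    (((x - 1) ^ (2 * (m - 1)) * ((x - 1) / (x ^ m - 1)) * x ^ (-s2 + (m - 1) * B) * P2) *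
      ((x⁻¹ ^ (K - 1)) ^ B * DD (x ^ K) (x⁻¹ ^ m) B)) =
    x ^ (-(s1 + B + s2)) * (x - 1) ^ (2 * (n - 1)) *
      (((x ^ (n : ℤ)) ^ (B : ℤ) - 1) / (x ^ (n : ℤ) - 1)) * P1 * P2 := by
  have h1 : x - 1 ≠ 0 := by have := hx 1 le_rfl; rw [pow_one] at this; exact sub_ne_zero.2 this
  have h2 : x ^ K - 1 ≠ 0 := sub_ne_zero.2 (hx _ hK)
  have h3 : x ^ m - 1 ≠ 0 := sub_ne_zero.2 (hx _ hm)
  have h4 : x ^ n - 1 ≠ 0 := sub_ne_zero.2 (hx _ (by omega))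
  have hxm : x ^ m ≠ 0 := pow_ne_zero _ hx0
  have e1 : (x ^ K - 1) * (1 - x⁻¹ ^ m) / (x ^ K - x⁻¹ ^ m) =
      (x ^ K - 1) * (x ^ m - 1) / (x ^ n - 1) := by
    have a1 : 1 - x⁻¹ ^ m = (x ^ m - 1) / x ^ m := by rw [inv_pow]; field_simp
    have a2 : x ^ K - x⁻¹ ^ m = (x ^ n - 1) / x ^ m := by
      rw [inv_pow, ← hn, pow_add]; field_simp
    rw [a1, a2]; field_simp
  have e2 : (x ^ K) ^ B - (x⁻¹ ^ m) ^ B = x ^ (-(m * B : ℤ)) * ((x ^ n) ^ B - 1) := by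
    rw [mul_sub, mul_one, inv_pow_eq, ← zpow_natCast _ B, ← zpow_natCast _ B, ← zpow_natCast _ B,
      ← zpow_natCast x K, ← zpow_natCast x n, ← zpow_mul, ← zpow_mul, ← zpow_mul, ← zpow_add₀ hx0, ← hn]
    push_cast
    ring_nf
  have e3 : (x⁻¹ ^ (K - 1)) ^ B = x ^ (-((K - 1) * B : ℤ)) := by
    rw [inv_pow_eq, ← zpow_natCast _ B, ← zpow_mul]
    push_cast [hK]
    ring_nf
  have e4 : x ^ (-(s1 + B + s2)) = x ^ (-s1 + (K - 1) * B) * x ^ (-s2 + (m - 1) * B) *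
      x ^ (-((K - 1) * B : ℤ)) * x ^ (-(m * B : ℤ)) := by
    rw [← zpow_add₀ hx0, ← zpow_add₀ hx0, ← zpow_add₀ hx0]
    congr 1; ring
  have e5 : (x - 1) ^ (2 * (n - 1)) = (x - 1) ^ (2 * (K - 1)) * (x - 1) ^ (2 * (m - 1)) * (x - 1) ^ 2 := by
    rw [← pow_add, ← pow_add]; congr 1; omega
  rw [DD, if_neg hB.ne', e1, e2, e3, e4, e5, zpow_natCast, zpow_natCast]
  generalize x ^ (-s1 + (K - 1) * B : ℤ) = z1
  generalize x ^ (-s2 + (m - 1) * B : ℤ) = z2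
  generalize x ^ (-((K - 1) * B : ℤ)) = z3
  generalize x ^ (-(m * B : ℤ)) = z4
  generalize (x - 1) ^ (2 * (K - 1)) = z5
  generalize (x - 1) ^ (2 * (m - 1)) = z6
  generalize x ^ K = y1 at *
  generalize x ^ m = y2 at *
  generalize x ^ n = y3 at *
  field_simp

lemma q_ne : q ≠ 0 := RatFunc.X_ne_zero

lemma q_pow_ne (k : ℕ) (hk : 1 ≤ k) : q ^ k ≠ 1 := by
  intro h
  have h' : algebraMap (Polynomial ℚ) (RatFunc ℚ) (Polynomial.X ^ k) =
      algebraMap (Polynomial ℚ) (RatFunc ℚ) 1 := by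
    rw [map_pow, map_one, RatFunc.algebraMap_X]; exact h
  have h2 := RatFunc.algebraMap_injective ℚ h'
  have := congrArg Polynomial.natDegree h2
  simp at this
  omega

lemma wt_eq : wt = DD q q⁻¹ := by
  funext r
  have h0 := q_ne
  have h1 : q ^ 2 - 1 ≠ 0 := sub_ne_zero.2 (q_pow_ne 2 (by norm_num))
  unfold wt DD
  split_ifs with h
  · rfl
  · have e1 : (q - 1) * (1 - q⁻¹) / (q - q⁻¹) = (q - 1) ^ 2 / (q ^ 2 - 1) := by
      have a1 : 1 - q⁻¹ = (q - 1) / q := by field_simp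
      have a2 : q - q⁻¹ = (q ^ 2 - 1) / q := by field_simp
      rw [a1, a2]; field_simp
    have e2 : q ^ r - q⁻¹ ^ r = q ^ (-(r : ℤ)) * (q ^ (2 * r) - 1) := by
      rw [← inv_pow_eq, mul_sub, mul_one, two_mul, pow_add, ← mul_assoc, ← mul_pow,
        inv_mul_cancel₀ h0, one_pow, one_mul]
    rw [e1, e2]; ring

lemma sum_split (n K m : ℕ) (hn : K + m = n) (hK : 1 ≤ K) (hm : 1 ≤ m) (a : ℕ → ℤ) :
    ∑ i ∈ Icc 1 (n - 1), a i = ∑ i ∈ Ico 1 K, a i + a K + ∑ k ∈ Ico 1 m, a (n - k) := by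
  have h : Icc 1 (n - 1) = Ico 1 n := by ext; simp; omega
  rw [h, ← sum_Ico_consecutive a (show 1 ≤ K + 1 by omega) (show K + 1 ≤ n by omega),
    sum_Ico_succ_top hK]
  congr 1
  refine sum_nbij' (fun i => n - i) (fun i => n - i) ?_ ?_ ?_ ?_ ?_ <;> intro i hi <;>
    simp only [mem_Ico] at * <;> try omega
  congr 1; omega
end KostantAux

theorem trace_product_formula (n m : ℕ) (hn : 2 ≤ n) (hm1 : 1 ≤ m) (hm2 : m ≤ n - 1)
    (a : ℕ → ℤ) (hpos : ∀ i ∈ Finset.Icc 1 (n - 1), 0 < a i)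
    (hdec : ∀ i, 1 ≤ i → i + 1 ≤ n - m → a (i + 1) < a i)
    (hinc : ∀ i, n - m ≤ i → i + 1 ≤ n - 1 → a i < a (i + 1)) :
    S n (∑ i ∈ Finset.Icc 1 (n - 1), a i • rootZ i (i + 1)) =
      q ^ (-(∑ i ∈ Finset.Icc 1 (n - 1), a i)) * (q - 1) ^ (2 * (n - 1)) *
        qint (q ^ (n : ℤ)) (a (n - m)) *
        (∏ i ∈ Finset.Icc 1 (n - m - 1), qint q (((i : ℤ) + 1) * a i - (i : ℤ) * a (i + 1))) *
        (∏ j ∈ Finset.Icc 1 (m - 1), qint q (((j : ℤ) + 1) * a (n - j) - (j : ℤ) * a (n - j - 1))) := by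
  obtain ⟨K, hK⟩ : ∃ K, K = n - m := ⟨_, rfl⟩
  have hKn : K + m = n := by omega
  have hK1 : 1 ≤ K := by omega
  obtain ⟨b, hb⟩ : ∃ b : ℕ → ℕ, ∀ i ∈ Finset.Icc 1 (n - 1), a i = b i :=
    ⟨fun i => (a i).toNat, fun i hi => by have := hpos i hi; simp only; omega⟩
  have hb' : ∀ i, 1 ≤ i → i ≤ n - 1 → a i = b i := fun i h1 h2 => hb i (Finset.mem_Icc.2 ⟨h1, h2⟩)
  have hdec' : ∀ i, 1 ≤ i → i + 1 ≤ K → b (i + 1) < b i := by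
    intro i h1 h2
    have := hdec i h1 (by omega)
    rw [hb' i (by omega) (by omega), hb' (i + 1) (by omega) (by omega)] at this
    omega
  have hinc' : ∀ i, K ≤ i → i + 1 ≤ n - 1 → b i < b (i + 1) := by
    intro i h1 h2
    have := hinc i (by omega) h2
    rw [hb' i (by omega) (by omega), hb' (i + 1) (by omega) (by omega)] at this
    omega
  have hbK : 0 < b K := by
    have := hpos K (Finset.mem_Icc.2 ⟨by omega, by omega⟩)
    rw [hb' K (by omega) (by omega)] at this
    omega
  rw [S_eq_Zr, wt_eq, Zmain q q_ne q_pow_ne n K m hKn hK1 hm1 b, prod_MM q q_ne q_pow_ne b K hK1,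
    prod_MM q q_ne q_pow_ne (fun k => b (n - k)) m hm1]
  · have e0 : n - m = K := by omega
    rw [e0, final_alg q q_ne q_pow_ne n K m hKn hK1 hm1 (b K) hbK, sum_split n K m hKn hK1 hm1 a]
    have i1 : Finset.Icc 1 (K - 1) = Finset.Ico 1 K := by ext; simp; omega
    have i2 : Finset.Icc 1 (m - 1) = Finset.Ico 1 m := by ext; simp; omega
    rw [i1, i2, hb' K (by omega) (by omega)]
    have t1 : ∑ i ∈ Finset.Ico 1 K, a i = ∑ i ∈ Finset.Ico 1 K, (b i : ℤ) :=
      Finset.sum_congr rfl fun i hi => by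
        rw [Finset.mem_Ico] at hi; exact hb' i (by omega) (by omega)
    have t2 : ∑ i ∈ Finset.Ico 1 m, a (n - i) = ∑ i ∈ Finset.Ico 1 m, (b (n - i) : ℤ) :=
      Finset.sum_congr rfl fun i hi => by
        rw [Finset.mem_Ico] at hi; exact hb' _ (by omega) (by omega)
    rw [t1, t2]
    congr 1
    · congr 1
      refine Finset.prod_congr rfl fun i hi => ?_
      rw [Finset.mem_Ico] at hi
      rw [qint, hb' i (by omega) (by omega), hb' (i + 1) (by omega) (by omega)]
    · refine Finset.prod_congr rfl fun i hi => ?_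
      rw [Finset.mem_Ico] at hi
      rw [qint, hb' (n - i) (by omega) (by omega), hb' (n - i - 1) (by omega) (by omega)]
      rfl
  · intro k h1 h2
    have := hinc' (n - (k + 1)) (by omega) (by omega)
    rwa [show n - (k + 1) + 1 = n - k by omega] at this
  · intro k h1 h2
    exact hdec' k h1 (by omega)
  · rw [lam_eval, if_pos (by omega), if_neg (by omega), hb' 1 (by omega) (by omega)]; simp
  · intro k h1 h2
    rw [lam_eval, if_pos (by omega), if_pos (by omega), hb' k (by omega) (by omega),
      hb' (k - 1) (by omega) (by omega)]
  · rw [lam_eval, if_neg (by omega), if_pos (by omega), hb' (n - 1) (by omega) (by omega)]; simp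
  · exact hdec'
  · exact hinc'
  · intro k hk
    rw [Finset.mem_Icc] at hk
    rw [lam_eval, if_neg (by omega), if_neg (by omega)]; simp
end

section
/- Let n ≥ 2 and 1 ≤ m ≤ n−1, and let a_1,…,a_{n−1} be real numbers satisfying a_1 > a_2 > ⋯ > a_{n−m}, a_{n−m} < a_{n−m+1} < ⋯ < a_{n−1}, and a_{n−m} > 0. Set v := Σ_{i=1}^{n−1} a_i α_i ∈ ℝ^n. If S is a set of positive roots of type A_{n−1} such that v is a nonnegative real linear combination of the elements of S, then |S| ≥ n−1. -/
/-- The positive root `α_{i,j} = e_i − e_j` of type `A_{n−1}` as a vector (1-based indices). -/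
noncomputable def rootR (i j : ℕ) : ℕ → ℝ := fun k => (if k = i then 1 else 0) - (if k = j then 1 else 0)

/-- The set of positive roots of type `A_{n−1}`. -/
def posRoots (n : ℕ) : Set (ℕ → ℝ) := {v | ∃ i j, 1 ≤ i ∧ i < j ∧ j ≤ n ∧ v = rootR i j}

theorem rootR_psum (i j t : ℕ) (hi : 1 ≤ i) (hj : 1 ≤ j) :
    ∑ k ∈ Finset.Icc 1 t, rootR i j k = (if i ≤ t then 1 else 0) - (if j ≤ t then 1 else 0) := by
  simp [rootR, Finset.sum_sub_distrib, hi, hj]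

theorem rootR_inj {i j i' j' : ℕ} (h : i < j) (h' : i' < j') (he : rootR i j = rootR i' j') :
    i = i' ∧ j = j' := by
  have h1 := congrFun he i
  have h2 := congrFun he j
  simp only [rootR] at h1 h2
  constructor
  · by_contra hne
    rw [if_pos trivial, if_neg (by omega), if_neg hne] at h1
    split_ifs at h1 <;> norm_num at h1
  · by_contra hne
    rw [if_pos trivial, if_neg (show ¬ j = i by omega), if_neg hne] at h2
    split_ifs at h2 <;> norm_num at h2

theorem big_chamber_element_needs_many_roots (n m : ℕ) (hn : 2 ≤ n) (hm1 : 1 ≤ m)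
    (hm2 : m ≤ n - 1) (a : ℕ → ℝ)
    (hdec : ∀ i, 1 ≤ i → i + 1 ≤ n - m → a (i + 1) < a i)
    (hinc : ∀ i, n - m ≤ i → i + 1 ≤ n - 1 → a i < a (i + 1))
    (hpos : 0 < a (n - m))
    (P : Finset (ℕ → ℝ)) (hP : ↑P ⊆ posRoots n)
    (c : (ℕ → ℝ) → ℝ) (hc : ∀ x ∈ P, 0 ≤ c x)
    (hv : (∑ i ∈ Finset.Icc 1 (n - 1), a i • rootR i (i + 1)) = ∑ x ∈ P, c x • x) :
    n - 1 ≤ P.card := by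
  have key : ∀ t, 1 ≤ t → t ≤ n - 1 →
      a t = ∑ x ∈ P, c x * ∑ k ∈ Finset.Icc 1 t, x k := by
    intro t ht1 ht2
    have h := congrArg (fun f : ℕ → ℝ => ∑ k ∈ Finset.Icc 1 t, f k) hv
    simp only [Finset.sum_apply, Pi.smul_apply, smul_eq_mul] at h
    rw [Finset.sum_comm, Finset.sum_comm (t := P)] at h
    simp only [← Finset.mul_sum] at h
    rw [← h, Finset.sum_eq_single_of_mem t (by simp; omega)]
    · rw [rootR_psum _ _ _ ht1 (by omega)]
      simp
    · intro b hb hne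
      have hb1 := (Finset.mem_Icc.mp hb).1
      rw [rootR_psum _ _ _ hb1 (by omega)]
      by_cases h1 : b ≤ t
      · rw [if_pos h1, if_pos (by omega)]; simp
      · rw [if_neg h1, if_neg (by omega)]; simp
  have key2 : ∀ k, 1 ≤ k → k + 1 ≤ n - 1 → a (k + 1) - a k = ∑ x ∈ P, c x * x (k + 1) := by
    intro k h1 h2
    rw [key k h1 (by omega), key (k + 1) (by omega) h2, ← Finset.sum_sub_distrib]
    refine Finset.sum_congr rfl fun x _ => ?_
    rw [Finset.sum_Icc_succ_top (by omega)]
    ring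
  have ex : ∀ k, ∃ i j, k ∈ Finset.Icc 1 (n - 1) → (i < j ∧ rootR i j ∈ P ∧
      (k = 1 → i ≤ n - m ∧ n - m < j) ∧ (2 ≤ k → k ≤ n - m → j = k) ∧
      (2 ≤ k → n - m < k → i = k)) := by
    intro k
    by_cases hk : k ∈ Finset.Icc 1 (n - 1)
    swap
    · exact ⟨0, 0, fun h => absurd h hk⟩
    obtain ⟨hk1, hk2⟩ := Finset.mem_Icc.mp hk
    by_cases hk0 : k = 1
    · have h := key (n - m) (by omega) (by omega)
      rw [h] at hpos
      obtain ⟨x, hx, hx0⟩ := Finset.exists_lt_of_sum_lt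
        (s := P) (f := fun _ => (0 : ℝ)) (by simpa using hpos)
      obtain ⟨i, j, hi, hij, hj, rfl⟩ := hP hx
      have h3 := pos_of_mul_pos_right hx0 (hc _ hx)
      rw [rootR_psum _ _ _ hi (by omega)] at h3
      refine ⟨i, j, fun _ => ⟨hij, hx, fun _ => ?_, by omega, by omega⟩⟩
      split_ifs at h3 <;> first | omega | (norm_num at h3)
    · obtain ⟨l, rfl⟩ : ∃ l, k = l + 1 := ⟨k - 1, by omega⟩
      have h := key2 l (by omega) hk2
      by_cases hkm : l + 1 ≤ n - m
      · have h4 := hdec l (by omega) hkm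
        obtain ⟨x, hx, hx0⟩ := Finset.exists_lt_of_sum_lt
          (s := P) (g := fun _ => (0 : ℝ)) (f := fun x => c x * x (l + 1))
          (by rw [← h]; simpa using h4)
        obtain ⟨i, j, hi, hij, hj, rfl⟩ := hP hx
        have h3 : rootR i j (l + 1) < 0 := by
          by_contra hcon
          exact absurd (mul_nonneg (hc _ hx) (not_lt.mp hcon)) (not_le.mpr hx0)
        refine ⟨i, j, fun _ => ⟨hij, hx, by omega, fun _ _ => ?_, by omega⟩⟩
        simp only [rootR] at h3
        split_ifs at h3 <;> first | omega | (norm_num at h3)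
      · have h4 := hinc l (by omega) hk2
        obtain ⟨x, hx, hx0⟩ := Finset.exists_lt_of_sum_lt
          (s := P) (f := fun _ => (0 : ℝ)) (g := fun x => c x * x (l + 1))
          (by rw [← h]; simpa using h4)
        obtain ⟨i, j, hi, hij, hj, rfl⟩ := hP hx
        have h3 := pos_of_mul_pos_right hx0 (hc _ hx)
        refine ⟨i, j, fun _ => ⟨hij, hx, by omega, by omega, fun _ _ => ?_⟩⟩
        simp only [rootR] at h3
        split_ifs at h3 <;> first | omega | (norm_num at h3)
  choose I J hIJ using ex
  have hcard := Finset.card_le_card_of_injOn (s := Finset.Icc 1 (n - 1)) (t := P)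
    (fun k => rootR (I k) (J k)) (fun k hk => (hIJ k hk).2.1) (by
      intro k hk k' hk' he
      obtain ⟨h1, -, h2, h3, h4⟩ := hIJ k hk
      obtain ⟨h1', -, h2', h3', h4'⟩ := hIJ k' hk'
      obtain ⟨e1, e2⟩ := rootR_inj h1 h1' he
      have hk := Finset.mem_Icc.mp hk
      have hk' := Finset.mem_Icc.mp hk'
      omega)
  simpa using hcard
end
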